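/- arXiv:2407.03803 — 2 statements merged into one kernel-verified Lean document; each statement's English description precedes it below -/
import Mathlib

section
/- The comass norm on p-forms on ℝ^n is invariant under the Hodge star operator: comass(∗b) = comass(b) for every p-form b. -/
open scoped BigOperators RealInnerProductSpace

/-- Comass of a k-form on a real inner product space: the supremum of |ω(v₁,…,v_k)|
over tuples of vectors of norm at most 1. -/
noncomputable def comass {E : Type*} [NormedAddCommGroup E] [InnerProductSpace ℝ E] {k : ℕ}
    (ω : E [⋀^Fin k]→ₗ[ℝ] ℝ) : ℝ :=
  sSup {r | ∃ v : Fin k → E, (∀ i, ‖v i‖ ≤ 1) ∧ r = |ω v|}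

/-- Wedge product of real-valued alternating forms (shuffle convention, so that the
wedge of dual basis covectors evaluates as a determinant). -/
noncomputable def wedge {E : Type*} [AddCommGroup E] [Module ℝ E] {p q : ℕ}
    (a : E [⋀^Fin p]→ₗ[ℝ] ℝ) (b : E [⋀^Fin q]→ₗ[ℝ] ℝ) :
    E [⋀^Fin (p + q)]→ₗ[ℝ] ℝ :=
  (TensorProduct.lid ℝ ℝ).toLinearMap.compAlternatingMap
    ((a.domCoprod b).domDomCongr finSumFinEquiv)

/-- The standard inner product of two k-forms on Euclidean n-space, for which the
increasing wedges of standard dual basis vectors are orthonormal. -/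
noncomputable def formInner {n k : ℕ}
    (a b : (EuclideanSpace ℝ (Fin n)) [⋀^Fin k]→ₗ[ℝ] ℝ) : ℝ :=
  (1 / (k.factorial : ℝ)) *
    ∑ f : Fin k → Fin n,
      a (fun i => EuclideanSpace.single (f i) 1) * b (fun i => EuclideanSpace.single (f i) 1)

/-- The standard volume form on Euclidean n-space. -/
noncomputable def vol (n : ℕ) : (EuclideanSpace ℝ (Fin n)) [⋀^Fin n]→ₗ[ℝ] ℝ :=
  (EuclideanSpace.basisFun (Fin n) ℝ).toBasis.det

section Comass

variable {E : Type*} [NormedAddCommGroup E] [InnerProductSpace ℝ E]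

/-- The wedge of the covectors dual to the vectors `u i`, evaluating as a Gram determinant. -/
noncomputable def gramForm {p : ℕ} (u : Fin p → E) : E [⋀^Fin p]→ₗ[ℝ] ℝ :=
  Matrix.detRowAlternating.compLinearMap (LinearMap.pi fun i => innerₛₗ ℝ (u i))

theorem gramForm_apply {p : ℕ} (u v : Fin p → E) :
    gramForm u v = Matrix.det (Matrix.of fun i j => ⟪u j, v i⟫) := rfl

theorem gramForm_self {p : ℕ} {u : Fin p → E} (hu : Orthonormal ℝ u) : gramForm u u = 1 := by
  rw [gramForm_apply, ← Matrix.det_one (n := Fin p)]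
  congr 1
  ext i j
  simp [orthonormal_iff_ite.mp hu, Matrix.one_apply, eq_comm]

theorem gramForm_eq_zero {p : ℕ} {u v : Fin p → E} (i : Fin p) (h : ∀ j, ⟪u j, v i⟫ = 0) :
    gramForm u v = 0 := by
  rw [gramForm_apply]
  exact Matrix.det_eq_zero_of_row_eq_zero i (by simpa using h)

/-- Wedging with a Gram form, evaluated on a basis adapted to an orthogonal splitting. -/
theorem wedge_gramForm_apply {p q : ℕ} {u : Fin p → E} (hu : Orthonormal ℝ u)
    {w : Fin q → E} (huw : ∀ i j, ⟪u i, w j⟫ = 0) (c : E [⋀^Fin q]→ₗ[ℝ] ℝ) :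
    wedge (gramForm u) c (Sum.elim u w ∘ finSumFinEquiv.symm) = c w := by
  have hx : (fun i => (Sum.elim u w ∘ finSumFinEquiv.symm) (finSumFinEquiv i)) = Sum.elim u w := by
    ext1 i; simp
  simp only [wedge, LinearMap.compAlternatingMap_apply, AlternatingMap.domDomCongr_apply,
    Function.comp_def (Sum.elim u w ∘ _) finSumFinEquiv, hx, AlternatingMap.domCoprod_apply,
    sum_apply, LinearEquiv.coe_coe, map_sum]
  let σ₀ : Equiv.Perm.ModSumCongr (Fin p) (Fin q) := Quotient.mk'' 1
  rw [Finset.sum_eq_single σ₀]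
  · rw [AlternatingMap.domCoprod.summand_mk'']
    simp [gramForm_self hu]
  · intro σ _ hσ
    induction σ using Quotient.inductionOn' with | _ σ
    rw [AlternatingMap.domCoprod.summand_mk'']
    obtain ⟨i, j, hij⟩ : ∃ i j, σ (Sum.inl i) = Sum.inr j := by
      by_contra! h
      refine hσ (Quotient.sound' ?_)
      rw [QuotientGroup.leftRel_apply, mul_one, inv_mem_iff]
      refine Equiv.Perm.mem_sumCongrHom_range_of_perm_mapsTo_inl ?_
      rintro _ ⟨i, rfl⟩
      rcases hs : σ (Sum.inl i) with k | k
      · exact ⟨k, rfl⟩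
      · exact absurd hs (h i k)
    have h0 : gramForm u (fun k => Sum.elim u w (σ (Sum.inl k))) = 0 :=
      gramForm_eq_zero i fun k => by simp [hij, huw]
    simp [h0]
  · simp

/-- Every value of an alternating form on a tuple in the unit ball is dominated by a value on an
orthonormal tuple. -/
theorem exists_orthonormal_abs_le [FiniteDimensional ℝ E] {k : ℕ}
    (hk : k ≤ Module.finrank ℝ E) (ω : E [⋀^Fin k]→ₗ[ℝ] ℝ) (v : Fin k → E)
    (hv : ∀ i, ‖v i‖ ≤ 1) :
    ∃ u : Fin k → E, Orthonormal ℝ u ∧ |ω v| ≤ |ω u| := by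
  by_cases hli : LinearIndependent ℝ v
  · let S := Submodule.span ℝ (Set.range v)
    have hS : Module.finrank ℝ S = k := by simpa using finrank_span_eq_card hli
    have : Fact (Module.finrank ℝ S = k) := ⟨hS⟩
    let e : OrthonormalBasis (Fin k) ℝ S := (stdOrthonormalBasis ℝ S).reindex (finCongr hS)
    let v' : Fin k → S := fun i => ⟨v i, Submodule.subset_span ⟨i, rfl⟩⟩
    have hdet : |e.toBasis.det v'| ≤ 1 := by
      obtain ⟨o⟩ : Nonempty (Orientation ℝ S (Fin k)) := ⟨e.toBasis.orientation⟩
      rw [← o.volumeForm_robust' e v']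
      exact (o.abs_volumeForm_apply_le v').trans
        (Finset.prod_le_one (fun _ _ => norm_nonneg _) fun i _ => hv i)
    have hω : ω v = ω (fun i => (e i : E)) * e.toBasis.det v' := by
      have h := congrArg (fun f => f v')
        ((ω.compLinearMap S.subtype).eq_smul_basis_det e.toBasis)
      simpa [v'] using h
    refine ⟨fun i => (e i : E), e.orthonormal.comp_linearIsometry S.subtypeₗᵢ, ?_⟩
    rw [hω, abs_mul]
    exact mul_le_of_le_one_right (abs_nonneg _) hdet
  · refine ⟨fun i => stdOrthonormalBasis ℝ E (Fin.castLE hk i),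
      (stdOrthonormalBasis ℝ E).orthonormal.comp _ (Fin.castLE_injective hk), ?_⟩
    rw [ω.map_linearDependent v hli, abs_zero]
    exact abs_nonneg _

theorem exists_orthonormal_orthogonal [FiniteDimensional ℝ E] {k l : ℕ}
    (hkl : k + l = Module.finrank ℝ E) {u : Fin k → E} (hu : Orthonormal ℝ u) :
    ∃ w : Fin l → E, Orthonormal ℝ w ∧ ∀ i j, ⟪u i, w j⟫ = 0 := by
  let S := Submodule.span ℝ (Set.range u)
  have hS : Module.finrank ℝ S = k := by simpa using finrank_span_eq_card hu.linearIndependent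
  have hSo : Module.finrank ℝ Sᗮ = l := S.finrank_add_finrank_orthogonal' (by rw [hS, hkl])
  let e : OrthonormalBasis (Fin l) ℝ Sᗮ := (stdOrthonormalBasis ℝ Sᗮ).reindex (finCongr hSo)
  exact ⟨fun i => (e i : E), e.orthonormal.comp_linearIsometry Sᗮ.subtypeₗᵢ, fun i j =>
    Submodule.inner_right_of_mem_orthogonal (K := S) (Submodule.subset_span ⟨i, rfl⟩) (e j).2⟩

theorem orthonormal_sumElim {ι κ : Type*} {u : ι → E} {w : κ → E} (hu : Orthonormal ℝ u)
    (hw : Orthonormal ℝ w) (huw : ∀ i j, ⟪u i, w j⟫ = 0) : Orthonormal ℝ (Sum.elim u w) := by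
  refine ⟨?_, ?_⟩
  · rintro (i | i)
    · exact hu.1 i
    · exact hw.1 i
  · rintro (i | i) (j | j) hij
    · exact hu.2 fun h => hij (congrArg _ h)
    · exact huw i j
    · exact (real_inner_comm _ _).trans (huw j i)
    · exact hw.2 fun h => hij (congrArg _ h)

/-- Comasses agree as soon as the absolute values agree on complementary orthonormal tuples. -/
theorem comass_eq_of_abs_eq [FiniteDimensional ℝ E] {p q : ℕ}
    (hpq : p + q = Module.finrank ℝ E) (b : E [⋀^Fin p]→ₗ[ℝ] ℝ) (c : E [⋀^Fin q]→ₗ[ℝ] ℝ)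
    (h : ∀ (u : Fin p → E) (w : Fin q → E), Orthonormal ℝ u → Orthonormal ℝ w →
      (∀ i j, ⟪u i, w j⟫ = 0) → |c w| = |b u|) :
    comass c = comass b := by
  refine csSup_eq_csSup_of_forall_exists_le ?_ ?_
  · rintro _ ⟨v, hv, rfl⟩
    obtain ⟨w, hw, hle⟩ := exists_orthonormal_abs_le (by omega) c v hv
    obtain ⟨u, hu, hwu⟩ := exists_orthonormal_orthogonal (l := p) (by omega) hw
    refine ⟨_, ⟨u, fun i => (hu.1 i).le, rfl⟩, hle.trans_eq (h u w hu hw fun i j => ?_)⟩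
    rw [real_inner_comm, hwu]
  · rintro _ ⟨v, hv, rfl⟩
    obtain ⟨u, hu, hle⟩ := exists_orthonormal_abs_le (by omega) b v hv
    obtain ⟨w, hw, huw⟩ := exists_orthonormal_orthogonal (l := q) (by omega) hu
    exact ⟨_, ⟨w, fun i => (hw.1 i).le, rfl⟩, hle.trans_eq (h u w hu hw huw).symm⟩

end Comass

theorem alternatingMap_apply_eq_sum_single {n p : ℕ}
    (b : (EuclideanSpace ℝ (Fin n)) [⋀^Fin p]→ₗ[ℝ] ℝ) (u : Fin p → EuclideanSpace ℝ (Fin n)) :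
    b u = ∑ f : Fin p → Fin n, (∏ i, u i (f i)) * b (fun i => EuclideanSpace.single (f i) 1) := by
  have hu : u = fun i => ∑ j, u i j • EuclideanSpace.single j (1 : ℝ) := by
    ext1 i
    simpa using ((EuclideanSpace.basisFun (Fin n) ℝ).sum_repr (u i)).symm
  have h := b.toMultilinearMap.map_sum (fun i j => u i j • EuclideanSpace.single j (1 : ℝ))
  rw [← hu] at h
  refine h.trans (Finset.sum_congr rfl fun f _ => ?_)
  exact b.toMultilinearMap.map_smul_univ _ _

theorem formInner_gramForm {n p : ℕ} (u : Fin p → EuclideanSpace ℝ (Fin n))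
    (b : (EuclideanSpace ℝ (Fin n)) [⋀^Fin p]→ₗ[ℝ] ℝ) : formInner (gramForm u) b = b u := by
  have key (σ : Equiv.Perm (Fin p)) :
      ∑ f : Fin p → Fin n, ((Equiv.Perm.sign σ : ℤ) : ℝ) * (∏ i, u i (f (σ i))) *
        b (fun i => EuclideanSpace.single (f i) 1) = b u := by
    have h := b.map_perm u σ⁻¹
    rw [alternatingMap_apply_eq_sum_single b (u ∘ _)] at h
    have h2 (f : Fin p → Fin n) : ∏ i, (u ∘ ⇑σ⁻¹) i (f i) = ∏ i, u i (f (σ i)) := by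
      rw [← Equiv.prod_comp σ]; simp
    simp only [h2] at h
    simp only [mul_assoc, ← Finset.mul_sum, h]
    rcases Int.units_eq_one_or (Equiv.Perm.sign σ) with hs | hs <;> simp [hs]
  have hfac : (p.factorial : ℝ) ≠ 0 := by positivity
  simp only [formInner, gramForm_apply, Matrix.det_apply', Finset.sum_mul]
  rw [Finset.sum_comm]
  simp [EuclideanSpace.inner_single_right, key, Fintype.card_perm, hfac]

theorem abs_vol_apply {n : ℕ} {x : Fin n → EuclideanSpace ℝ (Fin n)} (hx : Orthonormal ℝ x) :
    |vol n x| = 1 := by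
  obtain ⟨e, he⟩ := Orthonormal.exists_orthonormalBasis_extension_of_card_eq (𝕜 := ℝ)
    (v := x) (s := Set.univ) (by simp) (hx.comp _ Subtype.val_injective)
  obtain rfl : ⇑e = x := funext fun i => he i trivial
  rcases (EuclideanSpace.basisFun (Fin n) ℝ).det_to_matrix_orthonormalBasis_real e with h | h <;>
    simp [vol, h]

/-- The comass norm on p-forms on ℝ^n is invariant under the Hodge star:
comass(∗b) = comass(b). -/
theorem comass_hodge_star_eq (p q : ℕ)
    (hodge : ((EuclideanSpace ℝ (Fin (p + q))) [⋀^Fin p]→ₗ[ℝ] ℝ) →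
      ((EuclideanSpace ℝ (Fin (p + q))) [⋀^Fin q]→ₗ[ℝ] ℝ))
    (hhodge : ∀ (a : (EuclideanSpace ℝ (Fin (p + q))) [⋀^Fin p]→ₗ[ℝ] ℝ)
      (b : (EuclideanSpace ℝ (Fin (p + q))) [⋀^Fin p]→ₗ[ℝ] ℝ),
      wedge a (hodge b) = formInner a b • vol (p + q))
    (b : (EuclideanSpace ℝ (Fin (p + q))) [⋀^Fin p]→ₗ[ℝ] ℝ) :
    comass (hodge b) = comass b := by
  refine comass_eq_of_abs_eq (by simp) b (hodge b) fun u w hu hw huw => ?_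
  have h := congrArg (fun f => f (Sum.elim u w ∘ finSumFinEquiv.symm)) (hhodge (gramForm u) b)
  simp only [wedge_gramForm_apply hu huw, formInner_gramForm, AlternatingMap.smul_apply,
    smul_eq_mul] at h
  rw [h, abs_mul, abs_vol_apply ((orthonormal_sumElim hu hw huw).comp _
    finSumFinEquiv.symm.injective), mul_one]
end

section
/- For a 2-form a and a (2n−2)-form b on ℝ^(2n), the comass of a ∧ b satisfies comass(a ∧ b) ≤ n · comass(a) · comass(b). -/
open scoped BigOperators RealInnerProductSpace

open Module

section Comass

variable {E : Type*} [NormedAddCommGroup E] [InnerProductSpace ℝ E]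

theorem comass_nonneg {k : ℕ} (ω : E [⋀^Fin k]→ₗ[ℝ] ℝ) : 0 ≤ comass ω := by
  refine Real.sSup_nonneg ?_
  rintro r ⟨v, -, rfl⟩
  exact abs_nonneg _

theorem abs_apply_le_comass [FiniteDimensional ℝ E] {k : ℕ} (ω : E [⋀^Fin k]→ₗ[ℝ] ℝ)
    {v : Fin k → E} (hv : ∀ i, ‖v i‖ ≤ 1) : |ω v| ≤ comass ω := by
  let e := stdOrthonormalBasis ℝ E
  refine le_csSup ⟨∑ r : Fin k → Fin (finrank ℝ E), |ω fun i => e (r i)|, ?_⟩ ⟨v, hv, rfl⟩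
  rintro _ ⟨w, hw, rfl⟩
  have hexp : ω w = ∑ r : Fin k → Fin (finrank ℝ E),
      (∏ i, inner ℝ (e (r i)) (w i)) * ω fun i => e (r i) := by
    have h := ω.toMultilinearMap.map_sum fun i j => inner ℝ (e j) (w i) • e j
    simp only [e.sum_repr', MultilinearMap.map_smul_univ, smul_eq_mul] at h
    exact h
  rw [hexp]
  refine (Finset.abs_sum_le_sum_abs _ _).trans (Finset.sum_le_sum fun r _ => ?_)
  rw [abs_mul, Finset.abs_prod]
  refine mul_le_of_le_one_left (abs_nonneg _)
    (Finset.prod_le_one (fun i _ => abs_nonneg _) fun i _ => ?_)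
  exact (abs_real_inner_le_norm _ _).trans (by simpa using hw i)

/-- Hadamard's inequality for top-degree forms. -/
theorem abs_top_form_apply_le [FiniteDimensional ℝ E] {N : ℕ} (ω : E [⋀^Fin N]→ₗ[ℝ] ℝ)
    (g : OrthonormalBasis (Fin N) ℝ E) (v : Fin N → E) :
    |ω v| ≤ |ω g| * ∏ i, ‖v i‖ := by
  have : Fact (finrank ℝ E = N) := ⟨by simpa using finrank_eq_card_basis g.toBasis⟩
  have h := g.toBasis.orientation.abs_volumeForm_apply_le v
  rw [Orientation.volumeForm_robust _ g rfl] at h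
  have hω := congrArg (fun f => f v) (ω.eq_smul_basis_det g.toBasis)
  simp only [AlternatingMap.smul_apply, smul_eq_mul, OrthonormalBasis.coe_toBasis] at hω
  rw [hω, abs_mul]
  gcongr

/-- The wedge product, as a linear map in its first argument. -/
noncomputable def wedgeLeft {p q : ℕ} (b : E [⋀^Fin q]→ₗ[ℝ] ℝ) (v : Fin (p + q) → E) :
    (E [⋀^Fin p]→ₗ[ℝ] ℝ) →ₗ[ℝ] ℝ where
  toFun a := wedge a b v
  map_add' a a' := by
    simp [wedge, ← AlternatingMap.domCoprod'_apply, TensorProduct.add_tmul]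
  map_smul' c a := by
    simp [wedge, ← AlternatingMap.domCoprod'_apply, ← TensorProduct.smul_tmul']

/-- The decomposable two-form `x♭ ∧ y♭`. -/
noncomputable def flatWedge (x y : E) : E [⋀^Fin 2]→ₗ[ℝ] ℝ :=
  (Matrix.detRowAlternating (n := Fin 2) (R := ℝ)).compLinearMap
    (LinearMap.pi ![(innerSL ℝ x).toLinearMap, (innerSL ℝ y).toLinearMap])

theorem flatWedge_apply (x y : E) (u : Fin 2 → E) :
    flatWedge x y u = inner ℝ x (u 0) * inner ℝ y (u 1) - inner ℝ y (u 0) * inner ℝ x (u 1) := by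
  refine (Matrix.det_fin_two _).trans ?_
  simp

/-- On an orthonormal family, wedging with the two-form dual to the first two vectors evaluates
the other factor on the remaining vectors. -/
theorem flatWedge_wedge_apply {m : ℕ} (b : E [⋀^Fin m]→ₗ[ℝ] ℝ) {g : Fin 2 ⊕ Fin m → E}
    (hg : Orthonormal ℝ g) :
    wedge (flatWedge (g (Sum.inl 0)) (g (Sum.inl 1))) b (g ∘ finSumFinEquiv.symm) =
      b (g ∘ Sum.inr) := by
  have hinner := orthonormal_iff_ite.mp hg
  have key : (flatWedge (g (Sum.inl 0)) (g (Sum.inl 1))).domCoprod b g =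
      1 ⊗ₜ[ℝ] b (g ∘ Sum.inr) := by
    rw [AlternatingMap.domCoprod_apply, sum_apply]
    refine (Finset.sum_eq_single (Quotient.mk'' 1 : Equiv.Perm.ModSumCongr (Fin 2) (Fin m))
      ?_ ?_).trans ?_
    rotate_left 2
    · rw [AlternatingMap.domCoprod.summand_mk'']
      simp [flatWedge_apply, hinner, hg.norm_eq_one, Function.comp_def]
    · intro σ _ hσ
      induction σ using Quotient.inductionOn' with | _ σ
      have hmaps : ¬ Set.MapsTo σ (Set.range Sum.inl) (Set.range Sum.inl) := by
        intro h
        apply hσ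
        refine Quotient.sound' ?_
        rw [QuotientGroup.leftRel_apply]
        simpa using Equiv.Perm.mem_sumCongrHom_range_of_perm_mapsTo_inl h
      obtain ⟨k, j, hj⟩ : ∃ k j, σ (Sum.inl k) = Sum.inr j := by
        by_contra! hne
        apply hmaps
        rintro _ ⟨k, rfl⟩
        rcases hk : σ (Sum.inl k) with i | j
        · exact ⟨i, rfl⟩
        · exact (hne k j hk).elim
      rw [AlternatingMap.domCoprod.summand_mk'']
      have hzero : flatWedge (g (Sum.inl 0)) (g (Sum.inl 1)) (fun i => g (σ (Sum.inl i))) = 0 := by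
        rw [flatWedge_apply]
        fin_cases k <;> simp_all
      simp [hzero]
    · simp
  simp [wedge, Function.comp_assoc, key]

theorem abs_flatWedge_wedge_le [FiniteDimensional ℝ E] {m : ℕ} (hE : finrank ℝ E = 2 + m)
    (b : E [⋀^Fin m]→ₗ[ℝ] ℝ) {x y : E} (hx : ‖x‖ = 1) (hy : ‖y‖ = 1) (hxy : inner ℝ x y = 0)
    {v : Fin (2 + m) → E} (hv : ∀ i, ‖v i‖ ≤ 1) :
    |wedge (flatWedge x y) b v| ≤ comass b := by
  let w : Fin 2 ⊕ Fin m → E := Sum.elim ![x, y] 0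
  have hw : Orthonormal ℝ ((Set.range Sum.inl).domRestrict w) := by
    rw [orthonormal_iff_ite]
    rintro ⟨_, i, rfl⟩ ⟨_, j, rfl⟩
    have hyx : inner ℝ y x = 0 := by rw [real_inner_comm, hxy]
    fin_cases i <;> fin_cases j <;> simp [w, hx, hy, hxy, hyx]
  obtain ⟨g, hg⟩ := hw.exists_orthonormalBasis_extension_of_card_eq (by simpa using hE)
  have h0 : g (Sum.inl 0) = x := hg _ ⟨0, rfl⟩
  have h1 : g (Sum.inl 1) = y := hg _ ⟨1, rfl⟩
  have hmain := flatWedge_wedge_apply b g.orthonormal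
  rw [h0, h1] at hmain
  calc |wedge (flatWedge x y) b v|
      ≤ |wedge (flatWedge x y) b (g.reindex finSumFinEquiv)| * ∏ i, ‖v i‖ :=
        abs_top_form_apply_le _ _ v
    _ ≤ |wedge (flatWedge x y) b (g.reindex finSumFinEquiv)| * 1 := by
        gcongr
        exact Finset.prod_le_one (fun i _ => norm_nonneg _) fun i _ => hv i
    _ = |b (g ∘ Sum.inr)| := by rw [mul_one, OrthonormalBasis.coe_reindex, hmain]
    _ ≤ comass b := abs_apply_le_comass b fun i => by simp

theorem flatWedge_smul_right (x y : E) (c : ℝ) : flatWedge x (c • y) = c • flatWedge x y := by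
  ext u
  simp only [flatWedge_apply, AlternatingMap.smul_apply, inner_smul_left, smul_eq_mul,
    RCLike.conj_to_real]
  ring

theorem abs_flatWedge_wedge_le_norm_mul [FiniteDimensional ℝ E] {m : ℕ}
    (hE : finrank ℝ E = 2 + m) (b : E [⋀^Fin m]→ₗ[ℝ] ℝ) {x y : E} (hx : ‖x‖ = 1)
    (hxy : inner ℝ x y = 0) {v : Fin (2 + m) → E} (hv : ∀ i, ‖v i‖ ≤ 1) :
    |wedge (flatWedge x y) b v| ≤ ‖y‖ * comass b := by
  change |wedgeLeft b v (flatWedge x y)| ≤ _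
  rcases eq_or_ne y 0 with rfl | hy
  · have : flatWedge x (0 : E) = 0 := by simpa using flatWedge_smul_right x 0 0
    simp [this]
  · have hy' : ‖y‖ ≠ 0 := norm_ne_zero_iff.mpr hy
    have h := abs_flatWedge_wedge_le hE b hx (y := ‖y‖⁻¹ • y)
      (by rw [norm_smul, norm_inv, norm_norm, inv_mul_cancel₀ hy'])
      (by rw [inner_smul_right, hxy, mul_zero]) hv
    have hsmul : flatWedge x y = ‖y‖ • flatWedge x (‖y‖⁻¹ • y) := by
      rw [← flatWedge_smul_right, smul_smul, mul_inv_cancel₀ hy', one_smul]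
    rw [hsmul, map_smul, smul_eq_mul, abs_mul, abs_norm]
    gcongr
    exact h

/-- The vector dual to the interior product of `x` with a two-form. -/
theorem exists_inner_eq_apply [FiniteDimensional ℝ E] (a : E [⋀^Fin 2]→ₗ[ℝ] ℝ) (x : E) :
    ∃ y : E, ∀ u, inner ℝ y u = a ![x, u] := by
  let f : E →ₗ[ℝ] ℝ := a.toMultilinearMap.toLinearMap ![x, 0] 1
  refine ⟨(InnerProductSpace.toDual ℝ E).symm f.toContinuousLinearMap, fun u => ?_⟩
  rw [InnerProductSpace.toDual_symm_apply]
  have : Function.update ![x, 0] 1 u = ![x, u] := by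
    ext i; fin_cases i <;> simp
  simp [f, this]

theorem norm_le_comass_of_inner_eq [FiniteDimensional ℝ E] (a : E [⋀^Fin 2]→ₗ[ℝ] ℝ) {x y : E}
    (hx : ‖x‖ ≤ 1) (hy : ∀ u, inner ℝ y u = a ![x, u]) : ‖y‖ ≤ comass a := by
  rcases eq_or_ne y 0 with rfl | hy0
  · simpa using comass_nonneg a
  · have hne : ‖y‖ ≠ 0 := norm_ne_zero_iff.mpr hy0
    have h := abs_apply_le_comass a (v := ![x, ‖y‖⁻¹ • y]) (by
      intro i
      fin_cases i
      · simpa using hx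
      · simp [norm_smul, inv_mul_cancel₀ hne])
    rw [← hy, inner_smul_right, real_inner_self_eq_norm_mul_norm,
      inv_mul_cancel_left₀ hne, abs_norm] at h
    exact h

theorem apply_pair_swap (a : E [⋀^Fin 2]→ₗ[ℝ] ℝ) (x y : E) : a ![y, x] = -a ![x, y] := by
  have h := a.map_swap ![x, y] (i := 0) (j := 1) (by decide)
  rw [← h]
  congr 1
  ext i
  fin_cases i <;> simp

/-- A two-form is half the sum of the wedges of an orthonormal coframe with its contractions. -/
theorem two_smul_eq_sum_flatWedge {ι : Type*} [Fintype ι] (e : OrthonormalBasis ι ℝ E)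
    (a : E [⋀^Fin 2]→ₗ[ℝ] ℝ) {y : ι → E} (hy : ∀ i u, inner ℝ (y i) u = a ![e i, u]) :
    (2 : ℝ) • a = ∑ i, flatWedge (e i) (y i) := by
  have hexp (u w : E) : ∑ i, inner ℝ (e i) u * a ![e i, w] = a ![u, w] := by
    let f : E →ₗ[ℝ] ℝ := a.toMultilinearMap.toLinearMap ![0, w] 0
    have hf (z : E) : f z = a ![z, w] := by
      have : Function.update ![0, w] 0 z = ![z, w] := by
        ext i; fin_cases i <;> simp
      simp [f, this]
    have h := congrArg f (e.sum_repr' u)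
    rw [map_sum] at h
    simp only [map_smul, smul_eq_mul] at h
    simpa only [hf] using h
  ext u
  have hu : u = ![u 0, u 1] := by
    ext i; fin_cases i <;> rfl
  have h01 := hexp (u 0) (u 1)
  have h10 := hexp (u 1) (u 0)
  rw [apply_pair_swap a (u 0) (u 1)] at h10
  rw [← hu] at h01 h10
  let ev : (E [⋀^Fin 2]→ₗ[ℝ] ℝ) →+ ℝ :=
    { toFun := fun f => f u, map_zero' := rfl, map_add' := fun _ _ => rfl }
  have hsum : (∑ i, flatWedge (e i) (y i)) u = ∑ i, flatWedge (e i) (y i) u :=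
    map_sum ev _ _
  simp only [AlternatingMap.smul_apply, hsum, flatWedge_apply, hy,
    Finset.sum_sub_distrib, smul_eq_mul]
  simp only [mul_comm (a _) (inner ℝ _ _)]
  rw [h01, h10]
  ring

theorem two_mul_abs_wedge_le [FiniteDimensional ℝ E] {m : ℕ} (hE : finrank ℝ E = 2 + m)
    (a : E [⋀^Fin 2]→ₗ[ℝ] ℝ) (b : E [⋀^Fin m]→ₗ[ℝ] ℝ) {v : Fin (2 + m) → E}
    (hv : ∀ i, ‖v i‖ ≤ 1) :
    2 * |wedge a b v| ≤ (2 + m) * (comass a * comass b) := by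
  let e := (stdOrthonormalBasis ℝ E).reindex (finCongr hE)
  choose y hy using fun i => exists_inner_eq_apply a (e i)
  have hterm (i : Fin (2 + m)) :
      |wedgeLeft b v (flatWedge (e i) (y i))| ≤ comass a * comass b := by
    have hei : ‖e i‖ = 1 := e.norm_eq_one i
    have horth : inner ℝ (e i) (y i) = 0 := by
      rw [real_inner_comm, hy]
      exact a.map_eq_zero_of_eq _ (i := 0) (j := 1) rfl (by decide)
    refine (abs_flatWedge_wedge_le_norm_mul hE b hei horth hv).trans ?_
    gcongr
    · exact comass_nonneg b
    · exact norm_le_comass_of_inner_eq a hei.le (hy i)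
  have hsum := congrArg (wedgeLeft b v) (two_smul_eq_sum_flatWedge e a hy)
  rw [map_smul, map_sum, smul_eq_mul] at hsum
  calc 2 * |wedge a b v| = |2 * wedgeLeft b v a| := by rw [abs_mul, abs_two]; rfl
    _ ≤ ∑ i, |wedgeLeft b v (flatWedge (e i) (y i))| := by
        rw [hsum]; exact Finset.abs_sum_le_sum_abs _ _
    _ ≤ ∑ _i : Fin (2 + m), comass a * comass b := Finset.sum_le_sum fun i _ => hterm i
    _ = (2 + m) * (comass a * comass b) := by simp

end Comass

/-- For a 2-form a and a (2n−2)-form b on ℝ^(2n),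
comass(a ∧ b) ≤ n · comass(a) · comass(b). -/
theorem comass_wedge_two_form (n : ℕ) (hn : 1 ≤ n)
    (a : (EuclideanSpace ℝ (Fin (2 * n))) [⋀^Fin 2]→ₗ[ℝ] ℝ)
    (b : (EuclideanSpace ℝ (Fin (2 * n))) [⋀^Fin (2 * n - 2)]→ₗ[ℝ] ℝ) :
    comass (wedge a b) ≤ n * comass a * comass b := by
  have hE : finrank ℝ (EuclideanSpace ℝ (Fin (2 * n))) = 2 + (2 * n - 2) := by
    rw [finrank_euclideanSpace_fin]
    lia
  have hcast : (2 : ℝ) + ((2 * n - 2 : ℕ) : ℝ) = 2 * n := by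
    rw [Nat.cast_sub (by lia)]
    push_cast
    ring
  refine Real.sSup_le ?_ (mul_nonneg (mul_nonneg n.cast_nonneg (comass_nonneg a)) (comass_nonneg b))
  rintro r ⟨v, hv, rfl⟩
  have h := two_mul_abs_wedge_le hE a b hv
  rw [hcast] at h
  linarith
end
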